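/- Consider the planar system (S): x'(s) = b(s)·cos(x(s)) + sin(x(s)) and b'(s) = (1/2)·sin(x(s))·b(s)² − cos(x(s))·b(s). There do not exist differentiable functions x, b : [0, ∞) → ℝ solving (S) at every s ≥ 0 with x(0) = π/2 and b(0) > 0. (Hence the corresponding null geodesics of the compact 3-dimensional Lorentzian manifold with periodic null Killing field are incomplete.) -/

import Mathlib

/-- A function that is positive at `0` and satisfies the Riccati inequality `z' ≥ c z²` with `c > 0`
blows up in finite time, so it cannot be differentiable on all of `[0, ∞)`. -/
theorem not_forall_hasDerivAt_of_mul_sq_le {z z' : ℝ → ℝ} {c : ℝ} (hc : 0 < c) (h0 : 0 < z 0)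
    (hz : ∀ s, 0 ≤ s → HasDerivAt z (z' s) s) (hle : ∀ s, 0 ≤ s → c * z s ^ 2 ≤ z' s) :
    False := by
  have hmono : MonotoneOn z (Set.Ici 0) := by
    refine monotoneOn_of_hasDerivWithinAt_nonneg (f' := z') (convex_Ici 0)
      (fun s hs => (hz s hs).continuousAt.continuousWithinAt)
      (fun s hs => (hz s (interior_subset hs)).hasDerivWithinAt) fun s hs => ?_
    exact le_trans (by positivity) (hle s (interior_subset hs))
  have hpos : ∀ s, 0 ≤ s → 0 < z s := fun s hs =>
    h0.trans_le (hmono Set.self_mem_Ici hs hs)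
  have hderiv : ∀ s, 0 ≤ s →
      HasDerivAt (fun t => (z t)⁻¹ + c * t) (-z' s / z s ^ 2 + c * 1) s := fun s hs =>
    ((hz s hs).fun_inv (hpos s hs).ne').add ((hasDerivAt_id' s).const_mul c)
  have hanti : AntitoneOn (fun t => (z t)⁻¹ + c * t) (Set.Ici 0) := by
    refine antitoneOn_of_hasDerivWithinAt_nonpos (convex_Ici 0)
      (fun s hs => (hderiv s hs).continuousAt.continuousWithinAt)
      (fun s hs => (hderiv s (interior_subset hs)).hasDerivWithinAt) fun s hs => ?_
    have hs' : 0 ≤ s := interior_subset hs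
    have h := (le_div_iff₀ (pow_pos (hpos s hs') 2)).2 (hle s hs')
    rw [neg_div]
    linarith
  have hT : 0 ≤ (z 0)⁻¹ / c := by positivity
  have h := hanti Set.self_mem_Ici hT hT
  have hinv := inv_pos.2 (hpos _ hT)
  simp only [mul_zero, add_zero, mul_div_cancel₀ _ hc.ne'] at h
  linarith

/-- **Incompleteness of the null geodesics of the 3-dimensional example.**
Consider the system `(S)`: `x' = b·cos x + sin x`, `b' = (1/2)·sin(x)·b² − cos(x)·b`.
There is no solution `(x, b)` defined on all of `[0, ∞)` with `x 0 = π/2` and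
`b 0 > 0`: the corresponding null geodesics of the compact 3-dimensional
Lorentzian manifold with periodic null Killing field are incomplete. -/
theorem no_global_solution_reduced_system :
    ¬ ∃ x b : ℝ → ℝ,
        x 0 = Real.pi / 2 ∧ 0 < b 0 ∧
        ∀ s : ℝ, 0 ≤ s →
          HasDerivAt x (b s * Real.cos (x s) + Real.sin (x s)) s ∧
          HasDerivAt b (1 / 2 * Real.sin (x s) * (b s) ^ 2 - Real.cos (x s) * b s) s := by
  rintro ⟨x, b, hx0, hb0, h⟩
  refine not_forall_hasDerivAt_of_mul_sq_le (z := fun s => b s * Real.sin (x s))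
    (z' := fun s => b s ^ 2 - 1 / 2 * (b s * Real.sin (x s)) ^ 2) (c := 1 / 2) (by norm_num)
    (by simpa [hx0] using hb0) (fun s hs => ?_) fun s _ => ?_
  · obtain ⟨hx, hb⟩ := h s hs
    refine (hb.fun_mul hx.sin).congr_deriv ?_
    linear_combination b s ^ 2 * Real.sin_sq_add_cos_sq (x s)
  · nlinarith [mul_nonneg (sq_nonneg (b s)) (sub_nonneg.2 (Real.sin_sq_le_one (x s)))]
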